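/- Let 𝒢 be a quasi-compact ample groupoid all of whose orbits have the same finite number of elements. Then there exists a compact open subset Y ⊆ 𝒢⁰ meeting every orbit in exactly one point, and for any such Y the set 𝒢_Y^Y is a clopen subgroupoid of 𝒢 which is quasi-compact and is a group bundle (every g ∈ 𝒢_Y^Y satisfies s(g) = r(g)). -/

import Mathlib

universe u

/-- The algebraic operations of a groupoid (identified with its set of arrows):
a (partially meaningful) composition `gmul` and an inversion `ginv`.  The product
`gmul g h` is only required to behave like composition when `g` and `h` are
composable, i.e. when `src g = rng h`. -/
class GroupoidOps (G : Type u) where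
  gmul : G → G → G
  ginv : G → G

namespace GroupoidOps

variable {G : Type u} [GroupoidOps G]

/-- The source map `s g = g⁻¹ g`. -/
def src (g : G) : G := gmul (ginv g) g

/-- The range map `r g = g g⁻¹`. -/
def rng (g : G) : G := gmul g (ginv g)

/-- The unit space `𝒢⁰`: the set of identity arrows. -/
def unitSpace (G : Type u) [GroupoidOps G] : Set G := {x : G | src x = x}

end GroupoidOps

open GroupoidOps

/-- A topological groupoid: a groupoid `G`, identified with its arrow space, equipped
with a topology such that inversion is continuous and composition is continuous on the
set of composable pairs. -/
class TopologicalGroupoid (G : Type u) extends TopologicalSpace G, GroupoidOps G where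
  ginv_ginv : ∀ g : G, ginv (ginv g) = g
  gmul_src : ∀ g : G, gmul g (src g) = g
  rng_gmul : ∀ g : G, gmul (rng g) g = g
  gmul_assoc : ∀ g h k : G, src g = rng h → src h = rng k →
    gmul (gmul g h) k = gmul g (gmul h k)
  src_gmul : ∀ g h : G, src g = rng h → src (gmul g h) = src h
  rng_gmul_comp : ∀ g h : G, src g = rng h → rng (gmul g h) = rng g
  ginv_gmul : ∀ g h : G, src g = rng h → ginv (gmul g h) = gmul (ginv h) (ginv g)
  ginv_unit : ∀ x : G, src x = x → ginv x = x
  src_src : ∀ g : G, src (src g) = src g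
  src_rng : ∀ g : G, src (rng g) = rng g
  continuous_ginv : Continuous (ginv : G → G)
  continuous_gmul : Continuous fun p : {p : G × G // src p.1 = rng p.2} => gmul p.1.1 p.1.2

/-- An ample groupoid: a topological groupoid (not necessarily Hausdorff) whose unit
space is locally compact, Hausdorff and totally disconnected in the subspace topology,
and whose source map, viewed as a map `G → 𝒢⁰`, is a local homeomorphism. -/
class AmpleGroupoid (G : Type u) extends TopologicalGroupoid G where
  t2_unitSpace : T2Space (unitSpace G)
  locallyCompact_unitSpace : LocallyCompactSpace (unitSpace G)
  totallyDisconnected_unitSpace : TotallyDisconnectedSpace (unitSpace G)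
  isLocalHomeomorph_src :
    IsLocalHomeomorph fun g : G => (⟨src g, TopologicalGroupoid.src_src g⟩ : unitSpace G)

namespace TopologicalGroupoid

variable {G : Type u} [TopologicalGroupoid G]

/-- A bisection: an open subset on which both the source and the range map are injective. -/
def IsBisection (U : Set G) : Prop :=
  IsOpen U ∧ Set.InjOn (src : G → G) U ∧ Set.InjOn (rng : G → G) U

/-- A compact bisection: a bisection which is compact
(quasi-compact and Hausdorff in the subspace topology). -/
def IsCompactBisection (U : Set G) : Prop :=
  IsBisection U ∧ IsCompact U ∧ T2Space U

/-- Setwise inverse `U⁻¹ = { u⁻¹ : u ∈ U }`. -/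
def setInv (U : Set G) : Set G := ginv '' U

/-- Setwise product `UV = { uv : u ∈ U, v ∈ V, s(u) = r(v) }`. -/
def setMul (U V : Set G) : Set G :=
  {x : G | ∃ u ∈ U, ∃ v ∈ V, src u = rng v ∧ x = gmul u v}

/-- A subgroupoid: a subset closed under inversion and (composable) composition. -/
def IsSubgroupoid (H : Set G) : Prop :=
  (∀ g ∈ H, ginv g ∈ H) ∧ ∀ g ∈ H, ∀ h ∈ H, src g = rng h → gmul g h ∈ H

/-- A groupoid is principal if every isotropy element is a unit. -/
def IsPrincipal (G : Type u) [TopologicalGroupoid G] : Prop :=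
  ∀ g : G, src g = rng g → g ∈ unitSpace G

/-- The orbit of `x`, namely `r(s⁻¹(x))`. -/
def orbit (x : G) : Set G := {y : G | ∃ g : G, src g = x ∧ rng g = y}

/-- A subset of the unit space is invariant if it is a union of orbits. -/
def IsInvariant (U : Set G) : Prop := ∀ g : G, src g ∈ U → rng g ∈ U

/-- An inverse semigroup of compact bisections: a nonempty collection of compact
bisections closed under setwise product and setwise inverse. -/
def IsInvSemigroupOfCompactBisections (S : Set (Set G)) : Prop :=
  S.Nonempty ∧ (∀ U ∈ S, IsCompactBisection U) ∧
    (∀ U ∈ S, setInv U ∈ S) ∧ ∀ U ∈ S, ∀ V ∈ S, setMul U V ∈ S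

/-- The orbit equivalence relation `𝓡` on the unit space. -/
def orbitRel (G : Type u) [TopologicalGroupoid G] :
    unitSpace G → unitSpace G → Prop :=
  fun x y => ∃ g : G, src g = (x : G) ∧ rng g = (y : G)

end TopologicalGroupoid

open TopologicalGroupoid

open Set Topology in
/-- If all classes of the relation `∃ g, s g = x ∧ r g = y` have the same finite cardinality,
then every point has a clopen neighbourhood meeting each class at most once. -/
theorem exists_isClopen_subsingleton_classes {G X : Type*} [TopologicalSpace G]
    [TopologicalSpace X] [CompactSpace X] [T2Space X] [TotallyDisconnectedSpace X]
    {s r : G → X} (hs : IsOpenMap s) (hr : Continuous r)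
    (hrefl : ∀ x, ∃ g, s g = x ∧ r g = x) {n : ℕ}
    (hfin : ∀ x, {y | ∃ g, s g = x ∧ r g = y}.Finite)
    (hcard : ∀ x, {y | ∃ g, s g = x ∧ r g = y}.ncard = n) (x : X) :
    ∃ V : Set X, IsClopen V ∧ x ∈ V ∧ ∀ g, s g ∈ V → r g ∈ V → s g = r g := by
  obtain ⟨W, hW, hdisj⟩ := (hfin x).t2_separation
  have hopen : IsOpen (W x ∩ ⋂ z ∈ {y | ∃ g, s g = x ∧ r g = y}, s '' (r ⁻¹' W z)) :=
    (hW x).2.inter <| (hfin x).isOpen_biInter fun z _ => hs _ ((hW z).2.preimage hr)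
  have hx : x ∈ W x ∩ ⋂ z ∈ {y | ∃ g, s g = x ∧ r g = y}, s '' (r ⁻¹' W z) := by
    refine ⟨(hW x).1, mem_iInter₂.2 ?_⟩
    rintro z ⟨g, hg, rfl⟩
    exact ⟨g, (hW _).1, hg⟩
  obtain ⟨V, hV, hxV, hVsub⟩ := compact_exists_isClopen_in_isOpen hopen hx
  refine ⟨V, hV, hxV, fun g hsg hrg => ?_⟩
  have hmeet : ∀ z ∈ {y | ∃ g, s g = x ∧ r g = y},
      ∃ y ∈ {y | ∃ h, s h = s g ∧ r h = y}, y ∈ W z := fun z hz => by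
    obtain ⟨h, hh, hh'⟩ := mem_iInter₂.1 (hVsub hsg).2 z hz
    exact ⟨r h, ⟨h, hh', rfl⟩, hh⟩
  choose! f hf hfW using hmeet
  have hinj : InjOn f {y | ∃ g, s g = x ∧ r g = y} := fun z hz w hw hzw => by
    by_contra hne
    exact disjoint_left.1 (hdisj hz hw hne) (hfW z hz) (hzw ▸ hfW w hw)
  have himage : f '' {y | ∃ g, s g = x ∧ r g = y} = {y | ∃ h, s h = s g ∧ r h = y} :=
    eq_of_subset_of_ncard_le (image_subset_iff.2 hf)
      (by rw [hinj.ncard_image, hcard, hcard]) (hfin _)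
  have huniq : ∀ y ∈ {y | ∃ h, s h = s g ∧ r h = y}, y ∈ W x → y = f x := by
    intro y hy hyW
    obtain ⟨z, hz, rfl⟩ := himage.symm ▸ hy
    by_contra hne
    exact disjoint_left.1 (hdisj hz (hrefl x) fun h => hne (h ▸ rfl)) (hfW z hz) hyW
  rw [huniq (s g) (hrefl _) (hVsub hsg).1, huniq (r g) ⟨g, rfl, rfl⟩ (hVsub hrg).1]

open Set Topology in
/-- An equivalence relation on a compact, Hausdorff, totally disconnected space, given by two
continuous open maps out of a quasi-compact space, whose classes have the same finite cardinality,
admits a clopen transversal. -/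
theorem exists_isClopen_transversal {G X : Type*} [TopologicalSpace G] [CompactSpace G]
    [TopologicalSpace X] [CompactSpace X] [T2Space X] [TotallyDisconnectedSpace X]
    {s r : G → X} (hs : IsOpenMap s) (hs' : Continuous s) (hr : IsOpenMap r) (hr' : Continuous r)
    (hrefl : ∀ x, ∃ g, s g = x ∧ r g = x) (hsymm : ∀ g, ∃ h, s h = r g ∧ r h = s g)
    (htrans : ∀ g h, r g = s h → ∃ k, s k = s g ∧ r k = r h) {n : ℕ}
    (hfin : ∀ x, {y | ∃ g, s g = x ∧ r g = y}.Finite)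
    (hcard : ∀ x, {y | ∃ g, s g = x ∧ r g = y}.ncard = n) :
    ∃ Y : Set X, IsClopen Y ∧ ∀ x, ∃! y, y ∈ Y ∧ ∃ g, s g = x ∧ r g = y := by
  have hsat : ∀ V : Set X, IsClopen V → IsClopen (r '' (s ⁻¹' V)) := fun V hV =>
    ⟨((hV.1.preimage hs').isCompact.image hr').isClosed, hr _ (hV.2.preimage hs')⟩
  obtain ⟨Y, hY, hYone, hYsat⟩ : ∃ Y : Set X, IsClopen Y ∧
      (∀ g, s g ∈ Y → r g ∈ Y → s g = r g) ∧ univ ⊆ r '' (s ⁻¹' Y) := by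
    refine isCompact_univ.induction_on
      (p := fun S => ∃ Y : Set X, IsClopen Y ∧
        (∀ g, s g ∈ Y → r g ∈ Y → s g = r g) ∧ S ⊆ r '' (s ⁻¹' Y)) ?_ ?_ ?_ ?_
    · exact ⟨∅, isClopen_empty, fun g h => h.elim, empty_subset _⟩
    · rintro S T hST ⟨Y, hY, hY', hT⟩
      exact ⟨Y, hY, hY', hST.trans hT⟩
    · rintro S T ⟨Y, hY, hYone, hS⟩ ⟨Z, hZ, hZone, hT⟩
      refine ⟨Y ∪ (Z \ r '' (s ⁻¹' Y)), hY.union (hZ.diff (hsat Y hY)), ?_, ?_⟩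
      · rintro g (hsY | hsZ) (hrY | hrZ)
        · exact hYone g hsY hrY
        · exact (hrZ.2 ⟨g, hsY, rfl⟩).elim
        · obtain ⟨h, hh, hh'⟩ := hsymm g
          exact (hsZ.2 ⟨h, by rwa [mem_preimage, hh], hh'⟩).elim
        · exact hZone g hsZ.1 hrZ.1
      · rintro x (hx | hx)
        · obtain ⟨g, hg, rfl⟩ := hS hx
          exact ⟨g, Or.inl hg, rfl⟩
        · obtain ⟨g, hg, rfl⟩ := hT hx
          by_cases hgY : s g ∈ r '' (s ⁻¹' Y)
          · obtain ⟨h, hh, hh'⟩ := hgY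
            obtain ⟨k, hk, hk'⟩ := htrans h g hh'
            exact ⟨k, Or.inl (by rwa [hk]), hk'⟩
          · exact ⟨g, Or.inr ⟨hg, hgY⟩, rfl⟩
    · intro x _
      obtain ⟨V, hV, hxV, hVone⟩ :=
        exists_isClopen_subsingleton_classes hs hr' hrefl hfin hcard x
      refine ⟨V, mem_nhdsWithin_of_mem_nhds (hV.2.mem_nhds hxV), V, hV, hVone, fun y hy => ?_⟩
      obtain ⟨g, hg, hg'⟩ := hrefl y
      exact ⟨g, by rwa [mem_preimage, hg], hg'⟩
  refine ⟨Y, hY, fun x => ?_⟩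
  obtain ⟨g, hg, rfl⟩ := hYsat (mem_univ x)
  obtain ⟨h, hh, hh'⟩ := hsymm g
  refine ⟨s g, ⟨hg, h, hh, hh'⟩, ?_⟩
  rintro y ⟨hy, k, hk, rfl⟩
  obtain ⟨l, hl, hl'⟩ := htrans g k hk.symm
  rw [← hl, ← hl']
  exact (hYone l (by rwa [hl]) (by rwa [hl'])).symm

namespace TopologicalGroupoid

variable {G : Type u} [TopologicalGroupoid G]

theorem src_ginv (g : G) : src (ginv g) = rng g := by
  rw [src, ginv_ginv, rng]

theorem rng_ginv (g : G) : rng (ginv g) = src g := by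
  rw [rng, ginv_ginv, src]

theorem rng_eq_self {x : G} (hx : src x = x) : rng x = x := by
  rw [← src_ginv, ginv_unit x hx, hx]

/-- The source map, with values in the unit space. -/
def srcUnit (g : G) : unitSpace G := ⟨src g, src_src g⟩

/-- The range map, with values in the unit space. -/
def rngUnit (g : G) : unitSpace G := ⟨rng g, src_rng g⟩

theorem rngUnit_eq_srcUnit_comp_ginv : (rngUnit : G → unitSpace G) = srcUnit ∘ ginv :=
  funext fun g => Subtype.ext (src_ginv g).symm

/-- Inversion as a homeomorphism. -/
def ginvHomeomorph (G : Type u) [TopologicalGroupoid G] : G ≃ₜ G where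
  toFun := ginv
  invFun := ginv
  left_inv := ginv_ginv
  right_inv := ginv_ginv
  continuous_toFun := continuous_ginv
  continuous_invFun := continuous_ginv

theorem isSubgroupoid_restriction (Y : Set G) :
    IsSubgroupoid {g : G | src g ∈ Y ∧ rng g ∈ Y} := by
  refine ⟨fun g hg => ?_, fun g hg h hh hgh => ?_⟩
  · exact ⟨by rw [src_ginv]; exact hg.2, by rw [rng_ginv]; exact hg.1⟩
  · exact ⟨by rw [src_gmul g h hgh]; exact hh.1, by rw [rng_gmul_comp g h hgh]; exact hg.2⟩

theorem image_val_orbitRel (x : unitSpace G) :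
    Subtype.val '' {y : unitSpace G | ∃ g : G, srcUnit g = x ∧ rngUnit g = y} =
      orbit (x : G) := by
  ext y
  constructor
  · rintro ⟨_, ⟨g, rfl, rfl⟩, rfl⟩
    exact ⟨g, rfl, rfl⟩
  · rintro ⟨g, hg, rfl⟩
    exact ⟨rngUnit g, ⟨g, Subtype.ext hg, rfl⟩, rfl⟩

end TopologicalGroupoid

/-- Let `𝒢` be a quasi-compact ample groupoid all of whose orbits
have the same finite number of elements.  Then there is a compact open `Y ⊆ 𝒢⁰`
meeting every orbit exactly once, and for any such `Y` the set `𝒢_Y^Y` is a clopen,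
quasi-compact subgroupoid of `𝒢` which is a group bundle. -/
theorem transversal_group_bundle (G : Type u) [AmpleGroupoid G]
    [CompactSpace G] (n : ℕ)
    (horb : ∀ x ∈ unitSpace G, (orbit x).Finite ∧ (orbit x).ncard = n) :
    (∃ Y : Set G, Y ⊆ unitSpace G ∧ IsCompact Y ∧
      IsOpen (Subtype.val ⁻¹' Y : Set (unitSpace G)) ∧
      ∀ x ∈ unitSpace G, ∃! y : G, y ∈ Y ∩ orbit x) ∧
    ∀ Y : Set G, Y ⊆ unitSpace G → IsCompact Y →
      IsOpen (Subtype.val ⁻¹' Y : Set (unitSpace G)) →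
      (∀ x ∈ unitSpace G, ∃! y : G, y ∈ Y ∩ orbit x) →
      IsSubgroupoid {g : G | src g ∈ Y ∧ rng g ∈ Y} ∧
      IsOpen {g : G | src g ∈ Y ∧ rng g ∈ Y} ∧
      IsClosed {g : G | src g ∈ Y ∧ rng g ∈ Y} ∧
      IsCompact {g : G | src g ∈ Y ∧ rng g ∈ Y} ∧
      ∀ g ∈ {g : G | src g ∈ Y ∧ rng g ∈ Y}, src g = rng g := by
  have := AmpleGroupoid.t2_unitSpace (G := G)
  have := AmpleGroupoid.totallyDisconnected_unitSpace (G := G)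
  have hloc : IsLocalHomeomorph (srcUnit : G → unitSpace G) :=
    AmpleGroupoid.isLocalHomeomorph_src
  have hloc' : IsLocalHomeomorph (rngUnit : G → unitSpace G) := by
    rw [rngUnit_eq_srcUnit_comp_ginv]
    exact hloc.comp (ginvHomeomorph G).isLocalHomeomorph
  have : CompactSpace (unitSpace G) := Function.Surjective.compactSpace
    hloc.continuous fun x => ⟨(x : G), Subtype.ext x.2⟩
  constructor
  · obtain ⟨Y, hY, htr⟩ := exists_isClopen_transversal (n := n) hloc.isOpenMap hloc.continuous
      hloc'.isOpenMap hloc'.continuous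
      (fun x => ⟨x, Subtype.ext x.2, Subtype.ext (rng_eq_self x.2)⟩)
      (fun g => ⟨ginv g, Subtype.ext (src_ginv g), Subtype.ext (rng_ginv g)⟩)
      (fun g h hgh => ⟨gmul h g, Subtype.ext (src_gmul h g (congrArg Subtype.val hgh).symm),
        Subtype.ext (rng_gmul_comp h g (congrArg Subtype.val hgh).symm)⟩)
      (fun x => Set.Finite.of_finite_image
        (by rw [image_val_orbitRel]; exact (horb x x.2).1) Subtype.val_injective.injOn)
      (fun x => by
        rw [← Set.ncard_image_of_injective _ Subtype.val_injective, image_val_orbitRel]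
        exact (horb x x.2).2)
    refine ⟨Subtype.val '' Y, Subtype.coe_image_subset _ _,
      hY.1.isCompact.image continuous_subtype_val, ?_, fun x hx => ?_⟩
    · rw [Set.preimage_image_eq _ Subtype.val_injective]
      exact hY.2
    · obtain ⟨y, ⟨hy, g, hg, hg'⟩, huniq⟩ := htr ⟨x, hx⟩
      refine ⟨y, ⟨⟨y, hy, rfl⟩, g, congrArg Subtype.val hg, congrArg Subtype.val hg'⟩, ?_⟩
      rintro _ ⟨⟨z, hz, rfl⟩, h, hh, hh'⟩
      exact congrArg Subtype.val (huniq z ⟨hz, h, Subtype.ext hh, Subtype.ext hh'⟩)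
  · intro Y hYsub hYc hYo htr
    have hYclosed : IsClosed (Subtype.val ⁻¹' Y : Set (unitSpace G)) :=
      (Subtype.isCompact_iff.2 (by
        rwa [Subtype.image_preimage_coe, Set.inter_eq_right.2 hYsub])).isClosed
    have hclosed : IsClosed {g : G | src g ∈ Y ∧ rng g ∈ Y} :=
      (hYclosed.preimage hloc.continuous).inter (hYclosed.preimage hloc'.continuous)
    refine ⟨isSubgroupoid_restriction Y,
      (hYo.preimage hloc.continuous).inter (hYo.preimage hloc'.continuous),
      hclosed, hclosed.isCompact, fun g hg => ?_⟩
    exact (htr (src g) (src_src g)).unique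
      ⟨hg.1, src g, src_src g, rng_eq_self (src_src g)⟩ ⟨hg.2, g, rfl, rfl⟩
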